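/- For integers l ≥ 1, r ≥ 0, u ≥ 0, v ≥ 0 with r + v ≥ 1, the number C(l,r,u,v) of dual-ordered (u+v+r)-partitions of the set [l] ∪ {(l+1)*,...,(l+r)*} such that (a) each block contains zero, one, or two consecutive unasterisked elements, (b) the first u blocks contain no unasterisked element, and (c) the element (l+r)* lies in one of the first u+v blocks, equals l! r! ∑_{t=1}^{min(l, r+v)} C(t, l-t) C(r+v-1, t-1) C(2t+r, t-u-v) * (u t + (u+v)(t+r+v)) / (t (2t+r)). -/

import Mathlib

/-- Binomial coefficient with an integer lower index, vanishing for negative lower index. -/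
def chooseZ (a : ℕ) (b : ℤ) : ℕ := if 0 ≤ b then a.choose b.toNat else 0

/-- A block (a list over `Fin l ⊕ Fin r`, left = unasterisked, right = asterisked)
contains zero, one, or two consecutive unasterisked elements. -/
def GoodBlock {l r : ℕ} (b : List (Fin l ⊕ Fin r)) : Prop :=
  ∃ pre mid post : List (Fin l ⊕ Fin r),
    b = pre ++ mid ++ post ∧ (∀ x ∈ pre, x.isRight) ∧ (∀ x ∈ post, x.isRight) ∧
    (∀ x ∈ mid, x.isLeft) ∧ mid.length ≤ 2

/-- Dual-ordered `(u+v+r)`-partitions of `[l] ∪ {(l+1)*, …, (l+r)*}` (modelled as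
`Fin l ⊕ Fin r`) as in Lemma 4: an ordered list of blocks, each block a nonempty
inner-ordered list, covering every element exactly once, such that
(a) each block has at most two unasterisked elements, which are consecutive,
(b) the first `u` blocks contain no unasterisked element, and
(c) the element `(l+r)*` lies in one of the first `u+v` blocks. -/
def DualOrderedPartitions (l r u v : ℕ) : Set (List (List (Fin l ⊕ Fin r))) :=
  {P | P.length = u + v + r ∧ (∀ b ∈ P, b ≠ []) ∧ P.flatten.Nodup ∧
    (∀ x : Fin l ⊕ Fin r, x ∈ P.flatten) ∧
    (∀ b ∈ P, GoodBlock b) ∧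
    (∀ b ∈ P.take u, ∀ x ∈ b, x.isRight) ∧
    (∀ j : Fin r, (j : ℕ) = r - 1 → (Sum.inr j : Fin l ⊕ Fin r) ∈ (P.take (u + v)).flatten)}

namespace DOP
open Finset

/-! ### convolution of graded finite families -/

def conv {X Y Z : Type*} [DecidableEq Z] (op : X → Y → Z)
    (T₁ : ℕ → Finset X) (T₂ : ℕ → Finset Y) (s : ℕ) : Finset Z :=
  (antidiagonal s).biUnion fun p => Finset.image₂ op (T₁ p.1) (T₂ p.2)

lemma mem_conv {X Y Z : Type*} [DecidableEq Z] {op : X → Y → Z}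
    {T₁ : ℕ → Finset X} {T₂ : ℕ → Finset Y} {s : ℕ} {z : Z} :
    z ∈ conv op T₁ T₂ s ↔ ∃ a b, a + b = s ∧ ∃ x ∈ T₁ a, ∃ y ∈ T₂ b, op x y = z := by
  simp [conv, Finset.mem_image₂]

def Inj {X Y Z : Type*} (op : X → Y → Z)
    (T₁ : ℕ → Finset X) (T₂ : ℕ → Finset Y) : Prop :=
  ∀ a b a' b' x y x' y', x ∈ T₁ a → y ∈ T₂ b → x' ∈ T₁ a' → y' ∈ T₂ b' →
    op x y = op x' y' → a = a' ∧ b = b' ∧ x = x' ∧ y = y'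

lemma sum_conv {X Y Z R : Type*} [DecidableEq Z] [AddCommMonoid R] {op : X → Y → Z}
    {T₁ : ℕ → Finset X} {T₂ : ℕ → Finset Y} (h : Inj op T₁ T₂) (s : ℕ) (f : Z → R) :
    ∑ z ∈ conv op T₁ T₂ s, f z =
      ∑ p ∈ antidiagonal s, ∑ x ∈ T₁ p.1, ∑ y ∈ T₂ p.2, f (op x y) := by
  unfold conv
  rw [Finset.sum_biUnion]
  · refine Finset.sum_congr rfl fun p _ => ?_
    rw [← Finset.image_uncurry_product, Finset.sum_image, Finset.sum_product]
    · rfl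
    · rintro ⟨x, y⟩ hx ⟨x', y'⟩ hx' he
      simp only [coe_product, Set.mem_prod, mem_coe] at hx hx'
      obtain ⟨-, -, h1, h2⟩ := h _ _ _ _ _ _ _ _ hx.1 hx.2 hx'.1 hx'.2 he
      simp [h1, h2]
  · rintro p - q - hpq
    rw [Function.onFun, Finset.disjoint_left]
    intro z hz hz'
    rw [Finset.mem_image₂] at hz hz'
    obtain ⟨x, hx, y, hy, rfl⟩ := hz
    obtain ⟨x', hx', y', hy', he⟩ := hz'
    obtain ⟨h1, h2, -, -⟩ := h _ _ _ _ _ _ _ _ hx' hy' hx hy he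
    exact hpq (Prod.ext h1.symm h2.symm)

noncomputable def gf {X R : Type*} [CommRing R] (wt : X → R) (T : ℕ → Finset X) : PowerSeries R :=
  PowerSeries.mk fun s => ∑ z ∈ T s, wt z

lemma gf_conv {X Y Z R : Type*} [DecidableEq Z] [CommRing R] {op : X → Y → Z}
    {T₁ : ℕ → Finset X} {T₂ : ℕ → Finset Y} (h : Inj op T₁ T₂)
    (w₁ : X → R) (w₂ : Y → R) (w : Z → R) (hw : ∀ x y, w (op x y) = w₁ x * w₂ y) :
    gf w (conv op T₁ T₂) = gf w₁ T₁ * gf w₂ T₂ := by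
  ext s
  simp only [gf, PowerSeries.coeff_mk, PowerSeries.coeff_mul]
  rw [sum_conv h]
  refine Finset.sum_congr rfl fun p _ => ?_
  simp only [hw, Finset.sum_mul_sum]

/-! ### sequences of blocks -/

def tr (S : List (List Bool)) : ℕ := S.flatten.count true
def fa (S : List (List Bool)) : ℕ := S.flatten.count false

def seqs (F : ℕ → Finset (List Bool)) : ℕ → ℕ → Finset (List (List Bool))
  | 0 => fun s => if s = 0 then {[]} else ∅
  | n + 1 => conv List.cons F (seqs F n)

lemma mem_seqs {F : ℕ → Finset (List Bool)} (hF : ∀ c b, b ∈ F c → b.count true = c) (n s : ℕ)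
    (S : List (List Bool)) :
    S ∈ seqs F n s ↔ S.length = n ∧ (∀ b ∈ S, b ∈ F (b.count true)) ∧ tr S = s := by
  induction n generalizing s S with
  | zero =>
    by_cases hs : s = 0
    · simp only [seqs, hs, if_true, mem_singleton, List.length_eq_zero_iff]
      constructor
      · rintro rfl; simp [tr]
      · exact fun h => h.1
    · simp only [seqs, hs, if_false, notMem_empty, false_iff, List.length_eq_zero_iff]
      rintro ⟨rfl, -, h⟩
      exact hs (by simpa [tr] using h.symm)
  | succ n ih =>
    rw [seqs, mem_conv]
    constructor
    · rintro ⟨a, b, rfl, x, hx, y, hy, rfl⟩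
      rw [ih] at hy
      obtain ⟨h1, h2, h3⟩ := hy
      have := hF _ _ hx
      refine ⟨by simp [h1], ?_, ?_⟩
      · intro b hb
        rcases List.mem_cons.1 hb with rfl | hb
        · rwa [this]
        · exact h2 _ hb
      · rw [← h3, ← this]; simp [tr]
    · rintro ⟨h1, h2, h3⟩
      cases S with
      | nil => simp at h1
      | cons x y =>
        refine ⟨x.count true, tr y, by rw [← h3]; simp [tr], x, h2 _ (by simp), y, ?_, rfl⟩
        rw [ih]
        exact ⟨by simpa using h1, fun b hb => h2 b (by simp [hb]), rfl⟩

lemma inj_cons {F : ℕ → Finset (List Bool)} (hF : ∀ c b, b ∈ F c → b.count true = c) (n : ℕ) :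
    Inj List.cons F (seqs F n) := by
  intro a b a' b' x y x' y' hx hy hx' hy' h
  rw [List.cons.injEq] at h
  obtain ⟨rfl, rfl⟩ := h
  rw [mem_seqs hF] at hy hy'
  exact ⟨(hF _ _ hx).symm.trans (hF _ _ hx'), hy.2.2.symm.trans hy'.2.2, rfl, rfl⟩

noncomputable def wb (b : List Bool) : Polynomial ℚ := Polynomial.X ^ (b.count false)
noncomputable def wS (S : List (List Bool)) : Polynomial ℚ := Polynomial.X ^ (fa S)

lemma gf_seqs {F : ℕ → Finset (List Bool)} (hF : ∀ c b, b ∈ F c → b.count true = c) (n : ℕ) :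
    gf wS (seqs F n) = gf wb F ^ n := by
  induction n with
  | zero =>
    ext1 s
    simp only [gf, seqs, PowerSeries.coeff_mk, pow_zero, PowerSeries.coeff_one]
    split_ifs <;> simp [wS, fa]
  | succ n ih =>
    rw [seqs, gf_conv (inj_cons hF n) wb wS wS, ih, pow_succ']
    intro x y
    simp [wS, wb, fa, pow_add]

/-! ### the blocks -/

def pat (a m c : ℕ) : List Bool := List.replicate a true ++ List.replicate m false ++ List.replicate c true

def FA (c : ℕ) : Finset (List Bool) := if c = 0 then ∅ else {List.replicate c true}

def FM (m c : ℕ) : Finset (List Bool) := (antidiagonal c).image fun p => pat p.1 m p.2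

def FB (c : ℕ) : Finset (List Bool) := FA c ∪ (FM 1 c ∪ FM 2 c)

lemma count_true_pat (a m c : ℕ) : (pat a m c).count true = a + c := by
  simp [pat, List.count_replicate]
lemma count_false_pat (a m c : ℕ) : (pat a m c).count false = m := by
  simp [pat, List.count_replicate]

lemma mem_FA {c : ℕ} {b : List Bool} : b ∈ FA c ↔ c ≠ 0 ∧ b = List.replicate c true := by
  unfold FA; split_ifs with h <;> simp [h]

lemma mem_FM {m c : ℕ} {b : List Bool} : b ∈ FM m c ↔ ∃ x y, x + y = c ∧ b = pat x m y := by
  simp [FM, eq_comm]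

lemma hFA (c : ℕ) (b : List Bool) (h : b ∈ FA c) : b.count true = c := by
  rw [mem_FA] at h
  simp [h.2]

lemma hFM (m c : ℕ) (b : List Bool) (h : b ∈ FM m c) : b.count true = c := by
  rw [mem_FM] at h
  obtain ⟨x, y, h, rfl⟩ := h
  rw [count_true_pat, h]

lemma hFM' (m c : ℕ) (b : List Bool) (h : b ∈ FM m c) : b.count false = m := by
  rw [mem_FM] at h
  obtain ⟨x, y, h, rfl⟩ := h
  rw [count_false_pat]

lemma hFA' (c : ℕ) (b : List Bool) (h : b ∈ FA c) : b.count false = 0 := by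
  rw [mem_FA] at h
  simp [h.2, List.count_replicate]

lemma hFB (c : ℕ) (b : List Bool) (h : b ∈ FB c) : b.count true = c := by
  simp only [FB, mem_union] at h
  rcases h with h | h | h
  · exact hFA _ _ h
  · exact hFM _ _ _ h
  · exact hFM _ _ _ h

lemma pat_inj {a m c a' c' : ℕ} (hm : m ≠ 0) (h : pat a m c = pat a' m c') : a = a' := by
  obtain ⟨m, rfl⟩ := Nat.exists_eq_succ_of_ne_zero hm
  have key : ∀ a c, ((pat a (m + 1) c).takeWhile (fun x => x)).length = a := by
    intro a c
    induction a with
    | zero => simp [pat, List.replicate_succ]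
    | succ a ih =>
      simp only [pat, List.replicate_succ, List.cons_append] at ih ⊢
      simp
  rw [← key a c, ← key a' c']
  exact congrArg (fun l => (l.takeWhile (fun x => x)).length) h

lemma card_FM (m c : ℕ) (hm : m ≠ 0) : #(FM m c) = c + 1 := by
  rw [FM, Finset.card_image_of_injOn, Finset.Nat.card_antidiagonal]
  rintro ⟨a, b⟩ h ⟨a', b'⟩ h' he
  rw [mem_coe, HasAntidiagonal.mem_antidiagonal] at h h'
  simp only at h h'
  have := pat_inj hm he
  simp only [Prod.mk.injEq]
  omega

open Polynomial in
lemma sum_FM (m c : ℕ) (hm : m ≠ 0) : ∑ b ∈ FM m c, wb b = ((c : ℚ[X]) + 1) * Polynomial.X ^ m := by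
  rw [Finset.sum_congr rfl (g := fun _ => (Polynomial.X : ℚ[X]) ^ m)]
  · rw [Finset.sum_const, card_FM m c hm]; simp
  · intro b hb; rw [wb, hFM' _ _ _ hb]

lemma sum_FA (c : ℕ) : ∑ b ∈ FA c, wb b = if c = 0 then 0 else 1 := by
  unfold FA
  split_ifs <;> simp [wb, List.count_replicate]

noncomputable def XX : Polynomial ℚ := Polynomial.X + Polynomial.X ^ 2

lemma sum_FB (c : ℕ) : ∑ b ∈ FB c, wb b =
    (if c = 0 then 0 else 1) + (c + 1) * XX := by
  rw [FB, Finset.sum_union, Finset.sum_union, sum_FM _ _ one_ne_zero, sum_FM _ _ two_ne_zero, sum_FA, XX]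
  · ring
  · rw [Finset.disjoint_left]
    intro b h h'
    have := (hFM' _ _ _ h).symm.trans (hFM' _ _ _ h')
    omega
  · rw [Finset.disjoint_left]
    intro b h h'
    have h1 := (hFA' _ _ h)
    rw [mem_union] at h'
    rcases h' with h' | h' <;> (have := hFM' _ _ _ h'; omega)

noncomputable def II : PowerSeries (Polynomial ℚ) := PowerSeries.mk 1
noncomputable def AA : PowerSeries (Polynomial ℚ) := PowerSeries.X * II
noncomputable def BB : PowerSeries (Polynomial ℚ) := AA + PowerSeries.C XX * II ^ 2

lemma gf_FA : gf wb FA = AA := by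
  ext1 s
  rw [gf, PowerSeries.coeff_mk, sum_FA, AA, II]
  cases s with
  | zero => simp
  | succ n => rw [PowerSeries.coeff_succ_X_mul]; simp

lemma gf_FB : gf wb FB = BB := by
  ext1 s
  rw [BB, map_add, ← gf_FA, gf, gf, PowerSeries.coeff_mk, sum_FB, PowerSeries.coeff_mk, sum_FA,
    PowerSeries.coeff_C_mul, II, PowerSeries.mk_one_pow_eq_mk_choose_add, PowerSeries.coeff_mk]
  simp; ring

/-! ### shapes -/

def Sh2 (u v : ℕ) : ℕ → Finset (List (List Bool)) := conv (· ++ ·) (seqs FA u) (seqs FB v)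
def Sh (u v r : ℕ) : ℕ → Finset (List (List Bool)) := conv (· ++ ·) (Sh2 u v) (seqs FB r)

lemma tr_append (S T) : tr (S ++ T) = tr S + tr T := by simp [tr]
lemma fa_append (S T) : fa (S ++ T) = fa S + fa T := by simp [fa]

lemma inj_append {T₁ T₂ : ℕ → Finset (List (List Bool))} (n : ℕ)
    (h₁ : ∀ s S, S ∈ T₁ s → S.length = n ∧ tr S = s) (h₂ : ∀ s S, S ∈ T₂ s → tr S = s) :
    Inj (· ++ ·) T₁ T₂ := by
  intro a b a' b' x y x' y' hx hy hx' hy' h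
  obtain ⟨rfl, rfl⟩ := List.append_inj h ((h₁ _ _ hx).1.trans (h₁ _ _ hx').1.symm)
  exact ⟨(h₁ _ _ hx).2.symm.trans (h₁ _ _ hx').2, (h₂ _ _ hy).symm.trans (h₂ _ _ hy'), rfl, rfl⟩

lemma inj_Sh2 (u v : ℕ) : Inj (· ++ ·) (seqs FA u) (seqs FB v) := by
  apply inj_append u
  · intro s S h
    rw [mem_seqs hFA] at h
    exact ⟨h.1, h.2.2⟩
  · intro s S h
    rw [mem_seqs hFB] at h
    exact h.2.2

lemma Sh2_prop (u v s S) (h : S ∈ Sh2 u v s) : S.length = u + v ∧ tr S = s := by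
  rw [Sh2, mem_conv] at h
  obtain ⟨a, b, rfl, x, hx, y, hy, rfl⟩ := h
  rw [mem_seqs hFA] at hx
  rw [mem_seqs hFB] at hy
  simp [tr_append, hx.1, hy.1, hx.2.2, hy.2.2]

lemma inj_Sh (u v r : ℕ) : Inj (· ++ ·) (Sh2 u v) (seqs FB r) := by
  apply inj_append (u + v)
  · exact Sh2_prop u v
  · intro s S h
    rw [mem_seqs hFB] at h
    exact h.2.2

lemma gf_Sh2 (u v : ℕ) : gf wS (Sh2 u v) = AA ^ u * BB ^ v := by
  rw [Sh2, gf_conv (inj_Sh2 u v) wS wS wS, gf_seqs hFA, gf_seqs hFB, gf_FA, gf_FB]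
  intro x y; simp [wS, fa_append, pow_add]

lemma gf_Sh (u v r : ℕ) : gf wS (Sh u v r) = AA ^ u * BB ^ v * BB ^ r := by
  rw [Sh, gf_conv (inj_Sh u v r) wS wS wS, gf_seqs hFB, gf_FB, gf_Sh2]
  intro x y; simp [wS, fa_append, pow_add]

lemma sum_Sh (u v r s : ℕ) :
    ∑ S ∈ Sh u v r s, (tr (S.take (u + v)) : Polynomial ℚ) * wS S =
    PowerSeries.coeff s (PowerSeries.X * PowerSeries.derivative (Polynomial ℚ) (AA ^ u * BB ^ v) * BB ^ r) := by
  rw [Sh, sum_conv (inj_Sh u v r), PowerSeries.coeff_mul, ← gf_Sh2, ← gf_FB, ← gf_seqs hFB]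
  refine Finset.sum_congr rfl fun p _ => ?_
  have h : PowerSeries.coeff p.1 (PowerSeries.X * PowerSeries.derivative (Polynomial ℚ) (gf wS (Sh2 u v)))
      = (p.1 : Polynomial ℚ) * PowerSeries.coeff p.1 (gf wS (Sh2 u v)) := by
    cases p.1 with
    | zero => simp
    | succ n => rw [PowerSeries.coeff_succ_X_mul, PowerSeries.coeff_derivative]; push_cast; ring
  rw [h]
  simp only [gf, PowerSeries.coeff_mk]
  rw [mul_assoc, Finset.sum_mul_sum, Finset.mul_sum]
  refine Finset.sum_congr rfl fun x hx => ?_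
  rw [Finset.mul_sum]
  refine Finset.sum_congr rfl fun y hy => ?_
  obtain ⟨h1, h2⟩ := Sh2_prop _ _ _ _ hx
  rw [← h1, List.take_left, h2]
  simp [wS, fa_append, pow_add]

lemma mem_Sh (u v r s : ℕ) (S : List (List Bool)) :
    S ∈ Sh u v r s ↔ S.length = u + v + r ∧ (∀ b ∈ S, b ∈ FB (b.count true)) ∧
      (∀ b ∈ S.take u, b ∈ FA (b.count true)) ∧ tr S = s := by
  have hAB : ∀ c b, b ∈ FA c → b ∈ FB c := fun c b h => by simp [FB, h]
  constructor
  · intro h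
    rw [Sh, mem_conv] at h
    obtain ⟨a, b, rfl, x, hx, z, hz, rfl⟩ := h
    rw [Sh2, mem_conv] at hx
    obtain ⟨a, b, rfl, x, hx, y, hy, rfl⟩ := hx
    rw [mem_seqs hFA] at hx
    rw [mem_seqs hFB] at hy hz
    refine ⟨by simp [hx.1, hy.1, hz.1, add_assoc], ?_, ?_, by simp [tr_append, hx.2.2, hy.2.2, hz.2.2, add_assoc]⟩
    · intro b hb
      simp only [List.mem_append] at hb
      rcases hb with (hb | hb) | hb
      · exact hAB _ _ (hx.2.1 _ hb)
      · exact hy.2.1 _ hb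
      · exact hz.2.1 _ hb
    · have : (x ++ y ++ z).take u = x := by rw [← hx.1, List.append_assoc, List.take_left]
      intro b hb
      rw [this] at hb
      exact hx.2.1 _ hb
  · rintro ⟨h1, h2, h3, h4⟩
    rw [Sh, mem_conv]
    have e1 := List.take_append_drop (u + v) S
    have e2 := List.take_append_drop u (S.take (u+v))
    refine ⟨tr (S.take (u+v)), tr (S.drop (u+v)), by rw [← tr_append, e1, h4], S.take (u+v), ?_,
      S.drop (u+v), ?_, e1⟩
    · rw [Sh2, mem_conv]
      have e3 : (S.take (u+v)).take u = S.take u := by rw [List.take_take]; simp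
      refine ⟨tr ((S.take (u+v)).take u), tr ((S.take (u+v)).drop u), by rw [← tr_append, e2],
        _, ?_, _, ?_, e2⟩
      · rw [mem_seqs hFA, e3]
        exact ⟨by simp [h1]; omega, h3, rfl⟩
      · rw [mem_seqs hFB]
        exact ⟨by simp [h1], fun b hb => h2 b (List.mem_of_mem_take (List.mem_of_mem_drop hb)), rfl⟩
    · rw [mem_seqs hFB]
      exact ⟨by simp [h1], fun b hb => h2 b (List.mem_of_mem_drop hb), rfl⟩

/-! ### complete lists -/

def CL (n : ℕ) : Finset (List (Fin n)) :=
  (Finset.univ : Finset (Equiv.Perm (Fin n))).image fun (σ : Equiv.Perm (Fin n)) => List.ofFn (n := n) σ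

lemma CL_inj (n : ℕ) : Function.Injective (fun σ : Equiv.Perm (Fin n) => List.ofFn σ) := by
  intro σ τ h
  exact Equiv.coe_fn_injective (List.ofFn_injective h)

lemma card_CL (n : ℕ) : #(CL n) = n.factorial := by
  rw [CL, Finset.card_image_of_injective _ (CL_inj n), Finset.card_univ, Fintype.card_perm,
    Fintype.card_fin]

lemma mem_CL {n : ℕ} {L : List (Fin n)} : L ∈ CL n ↔ L.Nodup ∧ ∀ x, x ∈ L := by
  simp only [CL, mem_image, mem_univ, true_and]
  constructor
  · rintro ⟨σ, rfl⟩
    refine ⟨List.nodup_ofFn.2 σ.injective, fun x => ?_⟩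
    rw [List.mem_ofFn]
    exact σ.surjective x
  · rintro ⟨h1, h2⟩
    have hl : L.length = n := by
      have := Fintype.card_congr (List.Nodup.getEquivOfForallMemList L h1 h2)
      simpa using this
    refine ⟨(finCongr hl.symm).trans (List.Nodup.getEquivOfForallMemList L h1 h2), ?_⟩
    apply List.ext_getElem
    · simp [hl]
    · intro i h h'
      simp

lemma length_CL {n : ℕ} {L : List (Fin n)} (h : L ∈ CL n) : L.length = n := by
  simp only [CL, mem_image, mem_univ, true_and] at h
  obtain ⟨σ, rfl⟩ := h
  simp

lemma mem_take_ofFn {n : ℕ} (σ : Equiv.Perm (Fin n)) (k : ℕ) (j : Fin n) :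
    j ∈ (List.ofFn σ).take k ↔ ((σ⁻¹ j : Fin n) : ℕ) < k := by
  rw [List.mem_take_iff_getElem]
  constructor
  · rintro ⟨i, hi, h⟩
    simp only [List.getElem_ofFn] at h
    rw [← h]
    simp at hi ⊢
    omega
  · intro h
    refine ⟨(σ⁻¹ j : Fin n), by simp; omega, by simp⟩

noncomputable def decomp (n : ℕ) : Equiv.Perm (Fin (n+1)) ≃ Fin (n+1) × Equiv.Perm (Fin n) :=
  ((Equiv.inv _).trans (Equiv.mulRight (Equiv.swap 0 (Fin.last n)))).trans Equiv.Perm.decomposeFin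

lemma decomp_fst (n : ℕ) (σ : Equiv.Perm (Fin (n+1))) : (decomp n σ).1 = σ⁻¹ (Fin.last n) := by
  have key : ∀ e : Equiv.Perm (Fin (n+1)), (Equiv.Perm.decomposeFin e).1 = e 0 := by
    intro e
    obtain ⟨⟨p, e'⟩, rfl⟩ := Equiv.Perm.decomposeFin.symm.surjective e
    rw [Equiv.apply_symm_apply, Equiv.Perm.decomposeFin_symm_apply_zero]
  simp [decomp, key]

lemma card_CL_take (n k : ℕ) (hk : k ≤ n + 1) :
    #((CL (n+1)).filter fun L => ∀ j : Fin (n+1), (j : ℕ) = n + 1 - 1 → j ∈ L.take k)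
      = n.factorial * k := by
  rw [CL, Finset.filter_image, Finset.card_image_of_injective _ (CL_inj _)]
  have : (univ.filter fun σ : Equiv.Perm (Fin (n+1)) =>
      ∀ j : Fin (n+1), (j : ℕ) = n + 1 - 1 → j ∈ (List.ofFn σ).take k)
      = ((univ.filter fun i : Fin (n+1) => (i : ℕ) < k) ×ˢ univ).map (decomp n).symm.toEmbedding := by
    ext σ
    rw [Finset.mem_map_equiv]
    simp only [mem_filter, mem_univ, true_and, mem_product, and_true, Equiv.symm_symm, decomp_fst,
      mem_take_ofFn]
    constructor
    · intro h; exact h (Fin.last n) (by simp)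
    · intro h j hj
      have : j = Fin.last n := by ext; simpa using hj
      rwa [this]
  rw [this, Finset.card_map, Finset.card_product, Finset.card_univ, Fintype.card_perm,
    Fintype.card_fin, mul_comm, Fin.card_filter_val_lt]
  simp [hk]

/-! ### encoding -/

section enc
variable {α β : Type*}

def lefts (p : List (α ⊕ β)) : List α := p.filterMap Sum.getLeft?
def rights (p : List (α ⊕ β)) : List β := p.filterMap Sum.getRight?
def pattern (p : List (α ⊕ β)) : List Bool := p.map Sum.isRight

@[simp] lemma lefts_nil : lefts ([] : List (α ⊕ β)) = [] := rfl
@[simp] lemma rights_nil : rights ([] : List (α ⊕ β)) = [] := rfl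
@[simp] lemma pattern_nil : pattern ([] : List (α ⊕ β)) = [] := rfl
@[simp] lemma lefts_inl (a : α) (p : List (α ⊕ β)) : lefts (Sum.inl a :: p) = a :: lefts p := rfl
@[simp] lemma lefts_inr (a : β) (p : List (α ⊕ β)) : lefts (Sum.inr a :: p) = lefts p := rfl
@[simp] lemma rights_inl (a : α) (p : List (α ⊕ β)) : rights (Sum.inl a :: p) = rights p := rfl
@[simp] lemma rights_inr (a : β) (p : List (α ⊕ β)) : rights (Sum.inr a :: p) = a :: rights p := rfl
@[simp] lemma pattern_inl (a : α) (p : List (α ⊕ β)) : pattern (Sum.inl a :: p) = false :: pattern p := rfl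
@[simp] lemma pattern_inr (a : β) (p : List (α ⊕ β)) : pattern (Sum.inr a :: p) = true :: pattern p := rfl
lemma lefts_append (p q : List (α ⊕ β)) : lefts (p ++ q) = lefts p ++ lefts q := by simp [lefts]
lemma rights_append (p q : List (α ⊕ β)) : rights (p ++ q) = rights p ++ rights q := by simp [rights]
lemma mem_lefts {p : List (α ⊕ β)} {x : α} : x ∈ lefts p ↔ Sum.inl x ∈ p := by simp [lefts]
lemma mem_rights {p : List (α ⊕ β)} {x : β} : x ∈ rights p ↔ Sum.inr x ∈ p := by simp [rights]

lemma length_lefts (p : List (α ⊕ β)) : (lefts p).length = (pattern p).count false := by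
  induction p with
  | nil => rfl
  | cons a p ih => cases a <;> simp_all

lemma length_rights (p : List (α ⊕ β)) : (rights p).length = (pattern p).count true := by
  induction p with
  | nil => rfl
  | cons a p ih => cases a <;> simp_all

lemma enc_inj (p q : List (α ⊕ β)) (h : pattern p = pattern q) (hl : lefts p = lefts q)
    (hr : rights p = rights q) : p = q := by
  induction p generalizing q with
  | nil => cases q with
    | nil => rfl
    | cons a q => simp [pattern] at h
  | cons a p ih => cases q with
    | nil => simp [pattern] at h
    | cons b q =>
      cases a <;> cases b <;>
        simp only [pattern_inl, pattern_inr, lefts_inl, lefts_inr, rights_inl, rights_inr,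
          List.cons.injEq, reduceCtorEq, false_and, true_and] at h hl hr
      · rw [hl.1, ih q h hl.2 hr]
      · rw [hr.1, ih q h hl hr.2]

lemma enc_surj (s : List Bool) (L : List α) (R : List β) (hL : L.length = s.count false)
    (hR : R.length = s.count true) :
    ∃ p : List (α ⊕ β), pattern p = s ∧ lefts p = L ∧ rights p = R := by
  induction s generalizing L R with
  | nil => exact ⟨[], by simp_all [pattern, lefts, rights]⟩
  | cons a s ih =>
    cases a with
    | true =>
      cases R with
      | nil => simp at hR
      | cons b R =>
        obtain ⟨p, h1, h2, h3⟩ := ih L R (by simpa using hL) (by simpa using hR)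
        refine ⟨Sum.inr b :: p, ?_⟩
        simp [h1, h2, h3]
    | false =>
      cases L with
      | nil => simp at hL
      | cons b L =>
        obtain ⟨p, h1, h2, h3⟩ := ih L R (by simpa using hL) (by simpa using hR)
        refine ⟨Sum.inl b :: p, ?_⟩
        simp [h1, h2, h3]

lemma split_surj {γ δ : Type*} (f : γ → δ) (S : List (List δ)) (p : List γ) (h : p.map f = S.flatten) :
    ∃ P : List (List γ), P.flatten = p ∧ P.map (List.map f) = S := by
  induction S generalizing p with
  | nil => exact ⟨[], by simp_all⟩
  | cons s S ih =>
    rw [List.flatten_cons, List.map_eq_append_iff] at h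
    obtain ⟨p1, p2, rfl, h1, h2⟩ := h
    obtain ⟨P, rfl, h3⟩ := ih p2 h2
    exact ⟨p1 :: P, by simp, by simp [h1, h3]⟩

lemma nodup_iff (p : List (α ⊕ β)) : p.Nodup ↔ (lefts p).Nodup ∧ (rights p).Nodup := by
  induction p with
  | nil => simp [lefts, rights]
  | cons a p ih =>
    have h1 := @mem_lefts _ _ p
    have h2 := @mem_rights _ _ p
    cases a <;> simp [ih, h1, h2, and_assoc, and_left_comm]

def shape (P : List (List (α ⊕ β))) : List (List Bool) := P.map pattern

lemma flatten_shape (P : List (List (α ⊕ β))) : (shape P).flatten = pattern P.flatten := by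
  simp [shape, pattern, List.map_flatten]; rfl

lemma shape_inj (P Q : List (List (α ⊕ β))) (h : shape P = shape Q)
    (hl : lefts P.flatten = lefts Q.flatten) (hr : rights P.flatten = rights Q.flatten) : P = Q := by
  rw [List.eq_iff_flatten_eq]
  refine ⟨enc_inj _ _ ?_ hl hr, ?_⟩
  · rw [← flatten_shape, ← flatten_shape, h]
  · have := congrArg (List.map List.length) h
    simpa [shape, pattern, Function.comp_def] using this

lemma shape_surj (S : List (List Bool)) (L : List α) (R : List β) (hL : L.length = fa S)
    (hR : R.length = tr S) :
    ∃ P : List (List (α ⊕ β)), shape P = S ∧ lefts P.flatten = L ∧ rights P.flatten = R := by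
  obtain ⟨p, h1, h2, h3⟩ := enc_surj S.flatten L R hL hR
  obtain ⟨P, h4, h5⟩ := split_surj Sum.isRight S p h1
  exact ⟨P, h5, by rw [h4, h2], by rw [h4, h3]⟩

lemma rights_take (P : List (List (α ⊕ β))) (w : ℕ) :
    rights (P.take w).flatten = (rights P.flatten).take (tr ((shape P).take w)) := by
  have h : rights P.flatten = rights (P.take w).flatten ++ rights (P.drop w).flatten := by
    rw [← rights_append, ← List.flatten_append, List.take_append_drop]
  have h2 : tr ((shape P).take w) = (rights (P.take w).flatten).length := by
    rw [length_rights, tr, ← flatten_shape, shape, shape, List.map_take]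
  rw [h, h2, List.take_left]

end enc

lemma allRight_iff {α β : Type*} (b : List (α ⊕ β)) :
    (∀ x ∈ b, x.isRight) ↔ pattern b = List.replicate b.length true := by
  rw [List.eq_replicate_iff]
  simp [pattern]

lemma allLeft_iff {α β : Type*} (b : List (α ⊕ β)) :
    (∀ x ∈ b, x.isLeft) ↔ pattern b = List.replicate b.length false := by
  rw [List.eq_replicate_iff]
  simp [pattern]

lemma good_iff {l r : ℕ} (b : List (Fin l ⊕ Fin r)) :
    GoodBlock b ↔ ∃ a m c, m ≤ 2 ∧ pattern b = pat a m c := by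
  constructor
  · rintro ⟨pre, mid, post, rfl, h1, h2, h3, h4⟩
    refine ⟨pre.length, mid.length, post.length, h4, ?_⟩
    rw [allRight_iff] at h1 h2
    rw [allLeft_iff] at h3
    rw [pat, ← h1, ← h2, ← h3]
    simp [pattern]
  · rintro ⟨a, m, c, hm, h⟩
    rw [pat, pattern, List.map_eq_append_iff] at h
    obtain ⟨x, post, rfl, h, h3⟩ := h
    rw [List.map_eq_append_iff] at h
    obtain ⟨pre, mid, rfl, h1, h2⟩ := h
    have l1 := congrArg List.length h1
    have l2 := congrArg List.length h2
    have l3 := congrArg List.length h3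
    simp only [List.length_map, List.length_replicate] at l1 l2 l3
    refine ⟨pre, mid, post, rfl, ?_, ?_, ?_, by omega⟩
    · rw [allRight_iff, l1]; exact h1
    · rw [allRight_iff, l3]; exact h3
    · rw [allLeft_iff, l2]; exact h2

lemma FB_iff (s : List Bool) : s ∈ FB (s.count true) ↔ s ≠ [] ∧ ∃ a m c, m ≤ 2 ∧ s = pat a m c := by
  simp only [FB, mem_union, mem_FA, mem_FM]
  constructor
  · rintro (⟨h1, h2⟩ | ⟨x, y, h1, h2⟩ | ⟨x, y, h1, h2⟩)
    · refine ⟨by rintro rfl; simp at h1, s.count true, 0, 0, by omega, by simpa [pat] using h2⟩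
    · refine ⟨by rintro rfl; simp [pat] at h2, x, 1, y, by omega, h2⟩
    · refine ⟨by rintro rfl; simp [pat] at h2, x, 2, y, by omega, h2⟩
  · rintro ⟨h0, a, m, c, hm, h⟩
    have hc : s.count true = a + c := by rw [h, count_true_pat]
    interval_cases m
    · left
      have : s = List.replicate (a + c) true := by
        rw [h]; simp [pat]
      refine ⟨?_, by rwa [hc]⟩
      intro h'
      rw [hc] at h'
      rw [h'] at this
      exact h0 (by simpa using this)
    · right; left; exact ⟨a, c, hc.symm, h⟩
    · right; right; exact ⟨a, c, hc.symm, h⟩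

lemma FA_iff {α β : Type*} (b : List (α ⊕ β)) (hb : b ≠ []) :
    pattern b ∈ FA ((pattern b).count true) ↔ ∀ x ∈ b, x.isRight := by
  rw [mem_FA, allRight_iff]
  constructor
  · rintro ⟨h1, h2⟩
    have := congrArg List.length h2
    rw [List.length_replicate] at this
    rw [h2, ← this]; simp [pattern]
  · intro h
    have : (pattern b).count true = b.length := by rw [h]; simp
    rw [this]
    exact ⟨by simpa using hb, h⟩

def Triples (l r u v : ℕ) : Finset (List (List Bool) × List (Fin l) × List (Fin r)) :=
  (((Sh u v r r).filter fun S => fa S = l) ×ˢ (CL l ×ˢ CL r)).filter fun x =>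
    ∀ j : Fin r, (j : ℕ) = r - 1 → j ∈ x.2.2.take (tr (x.1.take (u + v)))

lemma mem_iff (l r u v : ℕ) (P : List (List (Fin l ⊕ Fin r))) :
    P ∈ DualOrderedPartitions l r u v ↔
      (shape P, lefts P.flatten, rights P.flatten) ∈ Triples l r u v := by
  have ht : tr (shape P) = (rights P.flatten).length := by
    rw [length_rights, tr, flatten_shape]
  have hf : fa (shape P) = (lefts P.flatten).length := by
    rw [length_lefts, fa, flatten_shape]
  have h1 : (∀ b ∈ shape P, b ∈ FB (b.count true)) ↔ (∀ b ∈ P, b ≠ []) ∧ (∀ b ∈ P, GoodBlock b) := by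
    simp only [FB_iff, good_iff, shape, List.forall_mem_map, ← forall_and]
    simp [pattern]
  have h2 : (∀ b ∈ P, b ≠ []) → ((∀ b ∈ (shape P).take u, b ∈ FA (b.count true)) ↔
      ∀ b ∈ P.take u, ∀ x ∈ b, x.isRight) := by
    intro hn
    rw [shape, ← List.map_take, List.forall_mem_map]
    exact forall₂_congr fun b hb => FA_iff b (hn b (List.mem_of_mem_take hb))
  have h3 : (∀ x : Fin l ⊕ Fin r, x ∈ P.flatten) ↔ (∀ x, x ∈ lefts P.flatten) ∧ ∀ x, x ∈ rights P.flatten := by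
    rw [Sum.forall]; simp only [mem_lefts, mem_rights]
  have h4 : (shape P).length = P.length := by simp [shape]
  simp only [Triples, mem_filter, mem_product, mem_Sh, DualOrderedPartitions, Set.mem_ofPred_eq, h4, h1,
    ← rights_take, mem_rights]
  rw [nodup_iff, h3]
  constructor
  · rintro ⟨a1, a2, ⟨a3, a4⟩, ⟨a5, a6⟩, a7, a8, a9⟩
    have b1 := mem_CL.2 ⟨a3, a5⟩
    have b2 := mem_CL.2 ⟨a4, a6⟩
    exact ⟨⟨⟨⟨a1, ⟨a2, a7⟩, (h2 a2).2 a8, by rw [ht, length_CL b2]⟩, by rw [hf, length_CL b1]⟩, b1, b2⟩, a9⟩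
  · rintro ⟨⟨⟨⟨a1, ⟨a2, a7⟩, a8, -⟩, -⟩, b1, b2⟩, a9⟩
    rw [mem_CL] at b1 b2
    exact ⟨a1, a2, ⟨b1.1, b2.1⟩, ⟨b1.2, b2.2⟩, a7, (h2 a2).1 a8, a9⟩

lemma card_eq (l r u v : ℕ) : Nat.card (DualOrderedPartitions l r u v) = #(Triples l r u v) := by
  have hinj : Set.InjOn (fun P : List (List (Fin l ⊕ Fin r)) =>
      (shape P, lefts P.flatten, rights P.flatten)) (DualOrderedPartitions l r u v) := by
    intro P _ Q _ h
    simp only [Prod.mk.injEq] at h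
    exact shape_inj P Q h.1 h.2.1 h.2.2
  rw [Nat.card_coe_set_eq, ← hinj.ncard_image, ← Set.ncard_coe_finset]
  congr 1
  ext ⟨S, L, R⟩
  constructor
  · rintro ⟨P, hP, h⟩
    rw [mem_iff] at hP
    rw [← h]
    exact hP
  · intro h
    have h' := h
    simp only [Triples, coe_filter, Set.mem_ofPred_eq, mem_product, mem_filter, mem_Sh] at h'
    obtain ⟨P, h1, h2, h3⟩ := shape_surj S L R
      (by rw [length_CL h'.1.2.1, h'.1.1.2]) (by rw [length_CL h'.1.2.2, h'.1.1.1.2.2.2])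
    refine ⟨P, ?_, by simp [h1, h2, h3]⟩
    rw [mem_iff, h1, h2, h3]
    exact h

lemma card_Triples (l r u v : ℕ) : #(Triples l r u v) =
    ∑ S ∈ (Sh u v r r).filter (fun S => fa S = l), l.factorial *
      #((CL r).filter fun L => ∀ j : Fin r, (j : ℕ) = r - 1 → j ∈ L.take (tr (S.take (u + v)))) := by
  rw [Triples, Finset.card_filter, Finset.sum_product]
  refine Finset.sum_congr rfl fun S _ => ?_
  rw [Finset.sum_product]
  rw [← card_CL l, ← smul_eq_mul, ← Finset.sum_const]
  refine Finset.sum_congr rfl fun x _ => ?_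
  rw [Finset.card_filter]

/-! ### power series computation -/

lemma coeff_AI (r m j : ℕ) :
    PowerSeries.coeff r (AA ^ m * II ^ (j + 1)) = ((r + j).choose (m + j) : Polynomial ℚ) := by
  have : AA ^ m * II ^ (j + 1) = PowerSeries.X ^ m * II ^ (m + j + 1) := by
    rw [AA]; ring
  rw [this, PowerSeries.coeff_X_pow_mul', II, PowerSeries.mk_one_pow_eq_mk_choose_add,
    PowerSeries.coeff_mk]
  split_ifs with h
  · congr 2; omega
  · rw [Nat.choose_eq_zero_of_lt (by omega)]; simp

lemma coeff_ABI (r a N j : ℕ) :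
    PowerSeries.coeff r (AA ^ a * BB ^ N * II ^ (j + 1)) =
      ∑ t ∈ range (N + 1), XX ^ t * ((N.choose t : ℕ) : Polynomial ℚ) *
        ((r + (2 * t + j)).choose (a + N + t + j) : Polynomial ℚ) := by
  have : AA ^ a * BB ^ N * II ^ (j + 1) = ∑ t ∈ range (N + 1),
      PowerSeries.C (XX ^ t * ((N.choose t : ℕ) : Polynomial ℚ)) * (AA ^ (a + (N - t)) * II ^ (2 * t + j + 1)) := by
    rw [BB, add_comm AA, add_pow, Finset.mul_sum, Finset.sum_mul]
    refine Finset.sum_congr rfl fun t _ => ?_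
    simp only [map_mul, map_pow, map_natCast]
    ring
  rw [this, map_sum]
  refine Finset.sum_congr rfl fun t ht => ?_
  rw [mem_range] at ht
  rw [PowerSeries.coeff_C_mul, coeff_AI]
  congr 3
  omega

lemma II_eq : II = 1 + PowerSeries.X * II := by
  ext1 s
  cases s with
  | zero => simp [II]
  | succ n => rw [map_add, PowerSeries.coeff_succ_X_mul]; simp [II, PowerSeries.coeff_one]

lemma d_mul {R : Type*} [CommRing R] (f g : PowerSeries R) :
    PowerSeries.derivative R (f * g) =
      f * PowerSeries.derivative R g + g * PowerSeries.derivative R f := by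
  rw [Derivation.leibniz]; simp only [smul_eq_mul]

lemma d_pow {R : Type*} [CommRing R] (f : PowerSeries R) (n : ℕ) :
    PowerSeries.derivative R (f ^ n) = n * f ^ (n - 1) * PowerSeries.derivative R f := by
  rw [Derivation.leibniz_pow]; simp only [smul_eq_mul, nsmul_eq_mul, mul_assoc]

lemma dI : PowerSeries.derivative (Polynomial ℚ) II = II ^ 2 := by
  ext1 s
  rw [PowerSeries.coeff_derivative, II, PowerSeries.mk_one_pow_eq_mk_choose_add]
  simp; ring

lemma dA : PowerSeries.derivative (Polynomial ℚ) AA = II ^ 2 := by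
  rw [AA, d_mul, dI, PowerSeries.derivative_X]
  linear_combination (-II) * II_eq

lemma dB : PowerSeries.derivative (Polynomial ℚ) BB = II ^ 2 + 2 * PowerSeries.C XX * II ^ 3 := by
  rw [BB, map_add, dA, d_mul, d_pow, dI, PowerSeries.derivative_C]
  push_cast
  ring

lemma dAB (u v r : ℕ) (hr : 1 ≤ r) :
    PowerSeries.X * PowerSeries.derivative (Polynomial ℚ) (AA ^ u * BB ^ v) * BB ^ r =
      PowerSeries.C (u : Polynomial ℚ) * (AA ^ u * BB ^ (r + v) * II ^ (0 + 1)) +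
      PowerSeries.C (v : Polynomial ℚ) * (AA ^ (u + 1) * BB ^ (r + v - 1) * II ^ (0 + 1)) +
      PowerSeries.C (2 * (v : Polynomial ℚ) * XX) * (AA ^ (u + 1) * BB ^ (r + v - 1) * II ^ (1 + 1)) := by
  rw [d_mul, d_pow, d_pow, dA, dB]
  simp only [map_mul, map_natCast, map_ofNat]
  have h1 : (u : PowerSeries (Polynomial ℚ)) * AA ^ (u - 1) * (PowerSeries.X * II) = (u : PowerSeries (Polynomial ℚ)) * AA ^ u := by
    cases u with
    | zero => simp
    | succ n => rw [← AA, Nat.add_sub_cancel]; ring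
  have h2 : (v : PowerSeries (Polynomial ℚ)) * BB ^ (v - 1) * BB ^ r = v * BB ^ (r + v - 1) := by
    cases v with
    | zero => simp
    | succ n =>
      rw [show r + (n + 1) - 1 = n + r by omega]; simp; ring
  have h3 : AA = PowerSeries.X * II := rfl
  have h4 : (AA : PowerSeries (Polynomial ℚ)) ^ (u + 1) = AA ^ u * (PowerSeries.X * II) := by
    rw [pow_succ]; rw [← h3]
  rw [h4]
  linear_combination (II * BB ^ r * BB ^ v) * h1 +
    AA ^ u * PowerSeries.X * (II ^ 2 + 2 * PowerSeries.C XX * II ^ 3) * h2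

lemma coeff_XX (t l : ℕ) : (XX ^ t).coeff l = if t ≤ l then (t.choose (l - t) : ℚ) else 0 := by
  have : XX ^ t = Polynomial.X ^ t * (1 + Polynomial.X) ^ t := by
    rw [XX, ← mul_pow]; ring
  rw [this, Polynomial.coeff_X_pow_mul']
  split_ifs with h
  · rw [Polynomial.coeff_one_add_X_pow]
  · rfl

lemma chooseZ_eq (t r u v : ℕ) :
    chooseZ (2 * t + r) ((t : ℤ) - u - v) = (r + 2 * t).choose (u + (r + v) + t) := by
  unfold chooseZ
  split_ifs with h
  · rw [add_comm r, ← Nat.choose_symm_of_eq_add]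
    omega
  · rw [Nat.choose_eq_zero_of_lt]; omega

lemma sum_wS (T : Finset (List (List Bool))) (l : ℕ) (g : List (List Bool) → ℕ) :
    ∑ S ∈ T.filter (fun S => fa S = l), (g S : ℚ) =
      (∑ S ∈ T, (g S : Polynomial ℚ) * wS S).coeff l := by
  rw [Polynomial.finsetSum_coeff, Finset.sum_filter]
  refine Finset.sum_congr rfl fun S _ => ?_
  rw [wS, Polynomial.coeff_mul_X_pow', ← Polynomial.C_eq_natCast, Polynomial.coeff_C]
  split_ifs <;> first | rfl | omega

lemma term_id (n u v s : ℕ) (hs : s ≤ n + v) :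
    (n.factorial : ℚ) * (u * ((n + v + 1).choose (s + 1) * ((n + 1) + 2 * (s + 1)).choose (u + (n + v + 1) + (s + 1)))
      + v * ((n + v).choose (s + 1) * ((n + 1) + 2 * (s + 1)).choose (u + (n + v + 1) + (s + 1)))
      + 2 * v * ((n + v).choose s * ((n + 1) + 2 * s + 1).choose (u + (n + v + 1) + (s + 1))))
    = ((n + 1).factorial : ℚ) * ((n + v).choose s * ((n + 1) + 2 * (s + 1)).choose (u + (n + v + 1) + (s + 1)) *
      (((u * (s + 1) + (u + v) * ((s + 1) + (n + 1) + v) : ℕ) : ℚ) / (((s + 1) * (2 * (s + 1) + (n + 1)) : ℕ) : ℚ))) := by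
  have a1 : ((n + v + 1).choose (s + 1) : ℚ) * (s + 1) = (n + v + 1) * (n + v).choose s := by
    have := Nat.add_one_mul_choose_eq (n + v) s
    exact_mod_cast this.symm
  have a2 : ((n + v).choose (s + 1) : ℚ) * (s + 1) = (n + v).choose s * (n + v - s) := by
    have := Nat.choose_succ_right_eq (n + v) s
    have h : ((n + v).choose (s + 1) : ℚ) * (s + 1) = (n + v).choose s * ((n + v - s : ℕ) : ℚ) := by
      exact_mod_cast this
    rw [h, Nat.cast_sub hs]; push_cast; ring
  have a3 : (((n + 1) + 2 * s + 1).choose (u + (n + v + 1) + (s + 1)) : ℚ) * (2 * (s + 1) + (n + 1)) =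
      ((n + 1) + 2 * (s + 1)).choose (u + (n + v + 1) + (s + 1)) * ((s : ℚ) + 1 - u - v) := by
    by_cases h : u + (n + v + 1) + (s + 1) ≤ (n + 1) + 2 * s + 1 + 1
    · have := Nat.choose_mul_succ_eq ((n + 1) + 2 * s + 1) (u + (n + v + 1) + (s + 1))
      rw [show (n + 1) + 2 * (s + 1) = (n + 1) + 2 * s + 1 + 1 by ring]
      have h' : (((n + 1) + 2 * s + 1).choose (u + (n + v + 1) + (s + 1)) : ℚ) * (((n + 1) + 2 * s + 1 + 1 : ℕ) : ℚ) =
        ((n + 1) + 2 * s + 1 + 1).choose (u + (n + v + 1) + (s + 1)) *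
          (((n + 1) + 2 * s + 1 + 1 - (u + (n + v + 1) + (s + 1)) : ℕ) : ℚ) := by
        exact_mod_cast this
      rw [Nat.cast_sub h] at h'
      push_cast at h'
      linear_combination h'
    · rw [Nat.choose_eq_zero_of_lt (by omega), Nat.choose_eq_zero_of_lt (by omega)]; simp
  have hs1 : (s : ℚ) + 1 ≠ 0 := by positivity
  have hs2 : 2 * ((s : ℚ) + 1) + (n + 1) ≠ 0 := by positivity
  rw [Nat.factorial_succ]
  push_cast
  generalize ((n + v + 1).choose (s + 1) : ℚ) = x1 at *
  generalize ((n + v).choose (s + 1) : ℚ) = x2 at *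
  generalize (((n + 1) + 2 * s + 1).choose (u + (n + v + 1) + (s + 1)) : ℚ) = E at *
  generalize (((n + 1) + 2 * (s + 1)).choose (u + (n + v + 1) + (s + 1)) : ℚ) = D at *
  generalize ((n + v).choose s : ℚ) = c at *
  have e1 : x1 = (n + v + 1) * c / (s + 1) := by rw [eq_div_iff hs1]; exact a1
  have e2 : x2 = c * (n + v - s) / (s + 1) := by rw [eq_div_iff hs1]; exact a2
  have e3 : E = D * ((s : ℚ) + 1 - u - v) / (2 * (s + 1) + (n + 1)) := by rw [eq_div_iff hs2]; exact a3
  rw [e1, e2, e3]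
  field_simp
  ring

lemma rhs_sum (l N : ℕ) (f : ℕ → ℚ) :
    ∑ t ∈ Finset.Icc 1 (min l (N + 1)), (t.choose (l - t) : ℚ) * f t =
      ∑ s ∈ range (N + 1), (XX ^ (s + 1)).coeff l * f (s + 1) := by
  have h1 : Finset.Icc 1 (min l (N + 1)) = (Finset.Icc 1 (N + 1)).filter (fun t => t ≤ l) := by
    ext t; simp only [mem_Icc, mem_filter]; omega
  rw [h1, Finset.sum_filter, Finset.range_eq_Ico, Finset.sum_Ico_add' (fun t => (XX ^ t).coeff l * f t) 0 (N+1) 1]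
  have h2 : Finset.Icc 1 (N + 1) = Finset.Ico (0 + 1) (N + 1 + 1) := by
    ext t; simp only [mem_Icc, mem_Ico]; omega
  rw [h2]
  refine Finset.sum_congr rfl fun t _ => ?_
  rw [coeff_XX]
  split_ifs <;> simp

lemma lhs_sum (l n u v : ℕ) (hl : 1 ≤ l) :
    (PowerSeries.coeff (n + 1) (PowerSeries.X * PowerSeries.derivative (Polynomial ℚ) (AA ^ u * BB ^ v) *
      BB ^ (n + 1))).coeff l = ∑ s ∈ range (n + v + 1), (XX ^ (s + 1)).coeff l *
      (u * ((n + v + 1).choose (s + 1) * ((n + 1) + 2 * (s + 1)).choose (u + (n + v + 1) + (s + 1)))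
      + v * ((n + v).choose (s + 1) * ((n + 1) + 2 * (s + 1)).choose (u + (n + v + 1) + (s + 1)))
      + 2 * v * ((n + v).choose s * ((n + 1) + 2 * s + 1).choose (u + (n + v + 1) + (s + 1)))) := by
  have h0 : (XX ^ 0).coeff l = 0 := by
    rw [pow_zero, Polynomial.coeff_one, if_neg (by omega)]
  have cc : ∀ (p : Polynomial ℚ) (a b : ℕ), (p * (a : Polynomial ℚ) * (b : Polynomial ℚ)).coeff l = p.coeff l * (a * b) := by
    intro p a b
    rw [← Polynomial.C_eq_natCast, ← Polynomial.C_eq_natCast, Polynomial.coeff_mul_C, Polynomial.coeff_mul_C]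
    simp [mul_assoc]
  rw [dAB _ _ _ (by omega), show n + 1 + v = n + v + 1 by ring, Nat.add_sub_cancel]
  simp only [map_add, PowerSeries.coeff_C_mul, coeff_ABI]
  rw [Finset.sum_range_succ' _ (n + v + 1)]
  have h3 : ∀ f : ℕ → Polynomial ℚ, f (n + v + 1) = 0 →
      ∑ t ∈ range (n + v + 1), f t = ∑ t ∈ range (n + v + 1), f (t + 1) + f 0 := by
    intro f hf
    rw [← Finset.sum_range_succ', Finset.sum_range_succ f (n + v + 1), hf, add_zero]
  rw [h3 (fun t => XX ^ t * (((n + v).choose t : ℕ) : Polynomial ℚ) *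
        ((n + 1 + (2 * t + 0)).choose (u + 1 + (n + v) + t + 0) : Polynomial ℚ))
      (by rw [Nat.choose_succ_self]; simp)]
  rw [show (2 * (v : Polynomial ℚ) * XX) = Polynomial.C (2 * (v : ℚ)) * XX by rw [Polynomial.C_mul, Polynomial.C_ofNat, Polynomial.C_eq_natCast], mul_assoc (Polynomial.C (2 * (v : ℚ)))]
  rw [← Polynomial.C_eq_natCast u, ← Polynomial.C_eq_natCast v, Finset.mul_sum]
  simp only [Polynomial.coeff_add, Polynomial.coeff_C_mul, Polynomial.finsetSum_coeff, ← mul_assoc XX, ← pow_succ', cc, h0,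
    zero_mul, add_zero]
  rw [Finset.mul_sum, Finset.mul_sum, Finset.mul_sum, ← Finset.sum_add_distrib, ← Finset.sum_add_distrib]
  refine Finset.sum_congr rfl fun s _ => ?_
  rw [show u + 1 + (n + v) + (s + 1) = u + (n + v + 1) + (s + 1) by ring,
    show u + 1 + (n + v) + s + 1 = u + (n + v + 1) + (s + 1) by ring,
    show n + 1 + (2 * s + 1) = n + 1 + 2 * s + 1 by ring]
  ring

lemma main_succ (l n u v : ℕ) (hl : 1 ≤ l) :
    (Nat.card (DualOrderedPartitions l (n + 1) u v) : ℚ) =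
      (l.factorial : ℚ) * ((n + 1).factorial : ℚ) *
        ∑ t ∈ Finset.Icc 1 (min l (n + 1 + v)),
          (t.choose (l - t) : ℚ) * ((n + 1 + v - 1).choose (t - 1) : ℚ) *
            (chooseZ (2 * t + (n + 1)) ((t : ℤ) - u - v) : ℚ) *
            (((u * t + (u + v) * (t + (n + 1) + v) : ℕ) : ℚ) / ((t * (2 * t + (n + 1)) : ℕ) : ℚ)) := by
  have h1 : Nat.card (DualOrderedPartitions l (n + 1) u v) = l.factorial * n.factorial *
      ∑ S ∈ (Sh u v (n+1) (n+1)).filter (fun S => fa S = l), tr (S.take (u + v)) := by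
    rw [card_eq, card_Triples, Finset.mul_sum]
    refine Finset.sum_congr rfl fun S hS => ?_
    rw [card_CL_take, mul_assoc]
    rw [mem_filter, mem_Sh] at hS
    have := hS.1.2.2.2
    rw [← List.take_append_drop (u + v) S, tr_append] at this
    omega
  rw [h1, Nat.cast_mul, Nat.cast_mul, Nat.cast_sum]
  rw [sum_wS, sum_Sh, lhs_sum _ _ _ _ hl]
  simp only [mul_assoc]
  rw [show n + 1 + v = n + v + 1 by ring, rhs_sum]
  congr 1
  rw [Finset.mul_sum, Finset.mul_sum]
  refine Finset.sum_congr rfl fun s hs => ?_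
  have := term_id n u v s (by rw [mem_range] at hs; omega)
  rw [chooseZ_eq, show n + 1 + v = n + v + 1 by ring, Nat.add_sub_cancel, Nat.add_sub_cancel]
  simp only [mul_assoc] at this ⊢
  linear_combination (XX ^ (s + 1)).coeff l * this

lemma main_zero (l u v : ℕ) (hv : 1 ≤ v) :
    (Nat.card (DualOrderedPartitions l 0 u v) : ℚ) =
      (l.factorial : ℚ) * ((0).factorial : ℚ) *
        ∑ t ∈ Finset.Icc 1 (min l (0 + v)),
          (t.choose (l - t) : ℚ) * ((0 + v - 1).choose (t - 1) : ℚ) *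
            (chooseZ (2 * t + 0) ((t : ℤ) - u - v) : ℚ) *
            (((u * t + (u + v) * (t + 0 + v) : ℕ) : ℚ) / ((t * (2 * t + 0) : ℕ) : ℚ)) := by
  obtain ⟨m, rfl⟩ : ∃ m, v = m + 1 := ⟨v - 1, by omega⟩
  have h1 : Nat.card (DualOrderedPartitions l 0 u (m + 1)) = l.factorial *
      ∑ S ∈ (Sh u (m + 1) 0 0).filter (fun S => fa S = l), 1 := by
    rw [card_eq, card_Triples, Finset.mul_sum]
    refine Finset.sum_congr rfl fun S hS => ?_
    rw [Finset.filter_true_of_mem (fun L _ j => j.elim0), card_CL]; simp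
  have h2 := sum_wS (Sh u (m + 1) 0 0) l (fun _ => 1)
  have h3 : ∑ S ∈ Sh u (m + 1) 0 0, wS S = if u = 0 then XX ^ (m + 1) else 0 := by
    have := congrArg (PowerSeries.coeff 0) (gf_Sh u (m + 1) 0)
    rw [gf, PowerSeries.coeff_mk] at this
    rw [this]
    simp only [PowerSeries.coeff_zero_eq_constantCoeff, map_mul, map_pow, pow_zero, mul_one, BB, AA, II, map_add]
    split_ifs with h <;> simp [h]
  rw [h1]
  simp only [Nat.cast_one, one_mul] at h2
  rw [Nat.cast_mul, Nat.cast_sum, Nat.cast_one, h2, h3]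
  simp only [mul_assoc, zero_add]
  rw [rhs_sum]
  simp only [Nat.factorial_zero, Nat.cast_one, one_mul]
  congr 1
  rw [Finset.sum_range_succ, Finset.sum_eq_zero, zero_add]
  · rw [chooseZ_eq]
    split_ifs with h
    · subst h
      rw [show 0 + (0 + (m + 1)) + (m + 1) = 0 + 2 * (m + 1) by ring]
      simp
      field_simp
      ring
    · rw [Nat.choose_eq_zero_of_lt (show 0 + 2 * (m + 1) < u + (0 + (m + 1)) + (m + 1) by omega)]
      simp
  · intro s hs
    rw [mem_range] at hs
    rw [chooseZ_eq, Nat.choose_eq_zero_of_lt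
      (show 0 + 2 * (s + 1) < u + (0 + (m + 1)) + (s + 1) by omega)]
    simp

end DOP

theorem stmt15 (l r u v : ℕ) (hl : 1 ≤ l) (hrv : 1 ≤ r + v) :
    (Nat.card (DualOrderedPartitions l r u v) : ℚ) =
      (l.factorial : ℚ) * (r.factorial : ℚ) *
        ∑ t ∈ Finset.Icc 1 (min l (r + v)),
          (t.choose (l - t) : ℚ) * ((r + v - 1).choose (t - 1) : ℚ) *
            (chooseZ (2 * t + r) ((t : ℤ) - u - v) : ℚ) *
            (((u * t + (u + v) * (t + r + v) : ℕ) : ℚ) / ((t * (2 * t + r) : ℕ) : ℚ)) := by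
  cases r with
  | zero => exact DOP.main_zero l u v (by omega)
  | succ n => exact DOP.main_succ l n u v hl
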